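/- Let p = ȳ_{λ_1}^{λ_2} ȳ_{λ_2}^{λ_3} ⋯ ȳ_{λ_k}^{λ_{k+1}} be an ascending path in Q̄_m^n with |λ_1| = 0 and |λ_{k+1}| = k (so each arrow raises the height by exactly 1). Let 1 < i ≤ k and suppose ν ≠ λ_i is a weight adjacent in Γ_m^n to both λ_{i−1} and λ_{i+1} with |λ_{i−1}| < |ν| < |λ_{i+1}|, and suppose in addition that there exists a weight κ adjacent in Γ_m^n to both λ_{i−1} and λ_{i+1} with |κ| < |λ_{i−1}|. Then in K̄_m^n = kQ̄_m^n / Ī_m^n the image of p equals the negative of the image of the path obtained from p by replacing λ_i with ν. -/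

import Mathlib

open scoped Classical

namespace Kh

abbrev Wt (N : ℕ) := Fin N → Bool

variable {N : ℕ}

/-- A weight of type `(m,n)`: `m` downs (`true`) and `n` ups (`false`). -/
def IsWeight (m n : ℕ) (l : Wt N) : Prop :=
  {i : Fin N | l i = true}.ncard = m ∧ {i : Fin N | l i = false}.ncard = n

/-- The height of a weight: sum over downs of the number of ups to the left. -/
noncomputable def height (l : Wt N) : ℕ :=
  ∑ i : Fin N, if l i = true then {j : Fin N | j < i ∧ l j = false}.ncard else 0

/-- Number of positions `t` with `i < t ≤ j` and value `b`. -/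
noncomputable def cnt (l : Wt N) (b : Bool) (i j : Fin N) : ℕ :=
  {t : Fin N | i < t ∧ t ≤ j ∧ l t = b}.ncard

/-- `(i,j)` is a matched pair ("circle") of the standard non-crossing bracket matching
of `l` (reading `true` = ↓ as an opening bracket and `false` = ↑ as a closing bracket):
`l i = ↓`, `l j = ↑`, the segment strictly between `i` and `j` is balanced and every
prefix of it has at least as many ↓'s as ↑'s. -/
def IsCircle (l : Wt N) (i j : Fin N) : Prop :=
  i < j ∧ l i = true ∧ l j = false ∧
    cnt l true i j + 1 = cnt l false i j ∧
    ∀ k : Fin N, i < k → k < j → cnt l false i k ≤ cnt l true i k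

/-- `s_C(λ)`: exchange the values of `l` at the two positions of the circle `C = (i,j)`. -/
def swapC (l : Wt N) (i j : Fin N) : Wt N :=
  fun t => if t = i then l j else if t = j then l i else l t

/-- The circle `(i,j)` encloses the circle `(i',j')`. -/
def Encloses (i j i' j' : Fin N) : Prop := i < i' ∧ j' < j

/-- The circle `(i,j)` lies to the left of the circle `(i',j')`. -/
def LeftOf (i j i' j' : Fin N) : Prop := j < i'

/-- The position `p` is unmatched in `l`. -/
def Unmatched (l : Wt N) (p : Fin N) : Prop :=
  ∀ q : Fin N, ¬ IsCircle l p q ∧ ¬ IsCircle l q p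

/-- `def(λ)`: the number of circles of `l`. -/
noncomputable def defect (l : Wt N) : ℕ :=
  {p : Fin N × Fin N | IsCircle l p.1 p.2}.ncard

/-- One step up in the graph `Γ_m^n`: `m' = s_C(l)` for some circle `C` of `l`. -/
def GammaStep (l m' : Wt N) : Prop :=
  ∃ i j : Fin N, IsCircle l i j ∧ m' = swapC l i j

/-- Adjacency in the graph `Γ_m^n`. -/
def GammaAdj (l m' : Wt N) : Prop := GammaStep l m' ∨ GammaStep m' l

/-- The order embedding `Fin N → Fin (N+2)` skipping the two positions `i`, `i+1`;
composing a weight with it deletes these two positions. -/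
def skip2 (i : ℕ) {N : ℕ} (t : Fin N) : Fin (N + 2) :=
  if (t : ℕ) < i then Fin.castLE (Nat.le_add_right N 2) t
  else ⟨(t : ℕ) + 2, Nat.add_lt_add_right t.isLt 2⟩

end Kh

namespace Kh

variable {N : ℕ}

/-- Type (I) elements of `S_m^n`: an ascending arrow into a vertex followed by a
descending arrow out of it (as vertex lists of the corresponding paths in `Q̄_m^n`). -/
def SType1 (p : List (Wt N)) : Prop :=
  ∃ x y z : Wt N, p = [x, y, z] ∧ GammaStep x y ∧ GammaStep z y

/-- Ascending type (II) elements of `S_m^n`: `ȳ_λ^ν ȳ_ν^μ` with `ν = s_C(λ)`,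
`μ = s_{C'}(ν)`, where `C'` is a circle of `λ` enclosed in `C` or lying to the right
of `C`. -/
def SType2Asc (p : List (Wt N)) : Prop :=
  ∃ (la : Wt N) (i j i' j' : Fin N),
    IsCircle la i j ∧ IsCircle la i' j' ∧
    (Encloses i j i' j' ∨ LeftOf i j i' j') ∧
    IsCircle (swapC la i j) i' j' ∧
    p = [la, swapC la i j, swapC (swapC la i j) i' j']

/-- Ascending type (III) elements of `S_m^n` (length `k ≥ 3`), written with 0-based
vertices `v 0, …, v k` (so `λ_t = v (t-1)`) and 1-based circles `C_i = (a i, b i)`. -/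
def SType3Asc (p : List (Wt N)) : Prop :=
  ∃ (k : ℕ) (v : ℕ → Wt N) (a b : ℕ → Fin N),
    3 ≤ k ∧
    p = List.ofFn (fun t : Fin (k + 1) => v t.val) ∧
    (∀ i, 1 ≤ i → i ≤ k →
      IsCircle (v (i - 1)) (a i) (b i) ∧ v i = swapC (v (i - 1)) (a i) (b i)) ∧
    (∀ i, 2 ≤ i → i ≤ k - 1 → ¬ IsCircle (v (i - 2)) (a i) (b i)) ∧
    (∀ j, 1 ≤ j → j ≤ k → IsCircle (v (j - 1)) (a k) (b k)) ∧
    Encloses (a 1) (b 1) (a k) (b k) ∧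
    (∀ i, 2 ≤ i → i ≤ k - 1 → LeftOf (a k) (b k) (a i) (b i))

/-- Membership in the reduction set `S_m^n` (vertex-list model: the descending
elements are the reverses of the ascending ones). -/
def InS (p : List (Wt N)) : Prop :=
  SType1 p ∨ SType2Asc p ∨ SType2Asc p.reverse ∨ SType3Asc p ∨ SType3Asc p.reverse

/-- A path in `Q̄_m^n` (given by its vertex list) is irreducible if no contiguous
subpath of it belongs to `S_m^n`. -/
def Irreducible (p : List (Wt N)) : Prop :=
  ∀ s, s <:+: p → ¬ InS s

/-- The number of ascending irreducible paths of length `k` from `la` to `mu`. -/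
noncomputable def ascCount (k : ℕ) (la mu : Wt N) : ℕ :=
  {p : List (Wt N) | p.length = k + 1 ∧ p.head? = some la ∧ p.getLast? = some mu ∧
    p.Chain' GammaStep ∧ Irreducible p}.ncard

/-- The total number of irreducible paths from `la` to `mu`. -/
noncomputable def irrCount (la mu : Wt N) : ℕ :=
  {p : List (Wt N) | p ≠ [] ∧ p.head? = some la ∧ p.getLast? = some mu ∧
    p.Chain' GammaAdj ∧ Irreducible p}.ncard

end Kh

namespace Kh

/-- The vertex set of `Q̄_m^n`: weights of type `(m,n)`. -/
def V (m n N : ℕ) := {l : Wt N // IsWeight m n l}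

/-- The arrow set of `Q̄_m^n`: for adjacent weights there is one arrow in each
direction (the ascending arrow `ȳ` and the descending arrow `x̄`); an arrow is an
ordered adjacent pair (source, target). -/
def E (m n N : ℕ) := {p : V m n N × V m n N // GammaAdj p.1.1 p.2.1}

/-- The free algebra on the vertices and arrows of `Q̄_m^n`; the path algebra
`kQ̄_m^n` is its quotient by the path-algebra relations `PARel`. -/
abbrev FA (F : Type*) [Field F] (m n N : ℕ) := FreeAlgebra F (V m n N ⊕ E m n N)

noncomputable def eV (F : Type*) [Field F] (m n N : ℕ) (v : V m n N) : FA F m n N :=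
  FreeAlgebra.ι F (Sum.inl v)

noncomputable def arE (F : Type*) [Field F] (m n N : ℕ) (a : E m n N) : FA F m n N :=
  FreeAlgebra.ι F (Sum.inr a)

/-- The idempotent `e_λ` attached to an arbitrary `l : Wt N` (zero if `l` is not
a weight of type `(m,n)`). -/
noncomputable def eW (F : Type*) [Field F] (m n N : ℕ) (l : Wt N) : FA F m n N :=
  if h : IsWeight m n l then eV F m n N ⟨l, h⟩ else 0

/-- The arrow from `u` to `w` (zero if `u`, `w` are not adjacent weights). -/
noncomputable def arW (F : Type*) [Field F] (m n N : ℕ) (u w : Wt N) : FA F m n N :=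
  if h : IsWeight m n u ∧ IsWeight m n w ∧ GammaAdj u w then
    arE F m n N ⟨(⟨u, h.1⟩, ⟨w, h.2.1⟩), h.2.2⟩
  else 0

/-- The element of the (free algebra presenting the) path algebra corresponding to
the path with the given vertex list. -/
noncomputable def pathEl (F : Type*) [Field F] (m n N : ℕ) : List (Wt N) → FA F m n N
  | [] => 0
  | [u] => eW F m n N u
  | u :: w :: rest => arW F m n N u w * pathEl F m n N (w :: rest)

/-- The defining relations of the path algebra `kQ̄_m^n` as a quotient of the free
algebra on vertices and arrows: the vertices are orthogonal idempotents summing to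
`1` and each arrow is supported at its source and target. -/
inductive PARel (F : Type*) [Field F] (m n N : ℕ) : FA F m n N → FA F m n N → Prop
  | idem (v : V m n N) : PARel F m n N (eV F m n N v * eV F m n N v) (eV F m n N v)
  | orth (v w : V m n N) (h : v ≠ w) : PARel F m n N (eV F m n N v * eV F m n N w) 0
  | src (a : E m n N) :
      PARel F m n N (eV F m n N a.1.1 * arE F m n N a) (arE F m n N a)
  | tgt (a : E m n N) :
      PARel F m n N (arE F m n N a * eV F m n N a.1.2) (arE F m n N a)
  | srcZero (v : V m n N) (a : E m n N) (h : v ≠ a.1.1) :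
      PARel F m n N (eV F m n N v * arE F m n N a) 0
  | tgtZero (a : E m n N) (v : V m n N) (h : v ≠ a.1.2) :
      PARel F m n N (arE F m n N a * eV F m n N v) 0
  | unit : PARel F m n N (∑ᶠ v : V m n N, eV F m n N v) 1

/-- The coefficient `c_κ^μ(λ)` where `λ = s_D(κ)` with `D = (d1,d2)`, and
`μ = s_C(λ)` with `C = (i,j)` a circle of `λ`. -/
noncomputable def cCoef {N : ℕ} (ka : Wt N) (d1 d2 i j : Fin N) : ℤ :=
  if IsCircle ka i j then
    if Encloses i j d1 d2 then
      (-1) ^ ({p : Fin N × Fin N |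
        IsCircle ka p.1 p.2 ∧ Encloses p.1 p.2 d1 d2 ∧ Encloses i j p.1 p.2}.ncard) * 2
    else 0
  else 1

/-- Generator of type (A): the sum of all length-2 paths from `la` to `mu`. -/
noncomputable def GenA (F : Type*) [Field F] (m n N : ℕ) (la mu : Wt N) : FA F m n N :=
  ∑ᶠ nu : Wt N, arW F m n N la nu * arW F m n N nu mu

/-- Generator of type (D): `ȳ_λ^μ x̄_λ^μ + Σ_κ c_κ^μ(λ) x̄_κ^λ ȳ_κ^λ`, for `λ` a
weight with circle `C = (i,j)` and `μ = s_C(λ)`. -/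
noncomputable def GenD (F : Type*) [Field F] (m n N : ℕ) (la : Wt N) (i j : Fin N) :
    FA F m n N :=
  arW F m n N la (swapC la i j) * arW F m n N (swapC la i j) la +
    ∑ᶠ ka : Wt N, ∑ᶠ d1 : Fin N, ∑ᶠ d2 : Fin N,
      if IsCircle ka d1 d2 ∧ la = swapC ka d1 d2 then
        cCoef ka d1 d2 i j • (arW F m n N la ka * arW F m n N ka la)
      else 0

/-- The relations presenting `K̄_m^n = kQ̄_m^n / Ī_m^n`: the path-algebra relations
together with the quadratic generators (A)–(D) of the ideal `Ī_m^n`. -/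
inductive KbarRel (F : Type*) [Field F] (m n N : ℕ) : FA F m n N → FA F m n N → Prop
  | pa {x y : FA F m n N} : PARel F m n N x y → KbarRel F m n N x y
  | genA (la mu : Wt N) (h1 : IsWeight m n la) (h2 : IsWeight m n mu) (hne : la ≠ mu)
      (htwo : 2 ≤ {nu : Wt N | GammaAdj la nu ∧ GammaAdj nu mu}.ncard) :
      KbarRel F m n N (GenA F m n N la mu) 0
  | genB1 (la : Wt N) (h : IsWeight m n la) (i j i' j' : Fin N)
      (hC : IsCircle la i j) (hC' : IsCircle la i' j') (henc : Encloses i j i' j')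
      (hno : ¬ ∃ a b : Fin N, IsCircle la a b ∧ Encloses a b i' j' ∧ Encloses i j a b) :
      KbarRel F m n N
        (arW F m n N la (swapC la i j) *
          arW F m n N (swapC la i j) (swapC (swapC la i j) i' j')) 0
  | genB2 (la : Wt N) (h : IsWeight m n la) (i j i' j' : Fin N)
      (hC : IsCircle la i j) (hC' : IsCircle la i' j') (henc : Encloses i j i' j')
      (hno : ¬ ∃ a b : Fin N, IsCircle la a b ∧ Encloses a b i' j' ∧ Encloses i j a b) :
      KbarRel F m n N
        (arW F m n N (swapC (swapC la i j) i' j') (swapC la i j) *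
          arW F m n N (swapC la i j) la) 0
  | genC (la mu : Wt N) (h1 : IsWeight m n la) (h2 : IsWeight m n mu) (hne : la ≠ mu)
      (c1 c2 d1 d2 : Fin N) (hC : IsCircle la c1 c2) (hC'' : IsCircle mu d1 d2)
      (hsw : swapC la c1 c2 = swapC mu d1 d2)
      (hcross : (c1 < d1 ∧ d1 < c2 ∧ c2 < d2) ∨ (d1 < c1 ∧ c1 < d2 ∧ d2 < c2)) :
      KbarRel F m n N
        (arW F m n N la (swapC la c1 c2) * arW F m n N (swapC la c1 c2) mu) 0
  | genD (la : Wt N) (h : IsWeight m n la) (i j : Fin N) (hC : IsCircle la i j) :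
      KbarRel F m n N (GenD F m n N la i j) 0

/-- The Koszul dual `K̄_m^n` of the extended Khovanov arc algebra, presented as a
quotient of the free algebra on the vertices and arrows of `Q̄_m^n`. -/
abbrev Kbar (F : Type*) [Field F] (m n N : ℕ) := RingQuot (KbarRel F m n N)

/-- The canonical projection; an element of the path algebra lies in the ideal
`Ī_m^n` if and only if its image under this map is zero. -/
noncomputable def toKbar (F : Type*) [Field F] (m n N : ℕ) :
    FA F m n N →ₐ[F] Kbar F m n N :=
  RingQuot.mkAlgHom F (KbarRel F m n N)

/-- The degree-`i` component of `K̄_m^n` (image of the span of the length-`i` paths). -/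
noncomputable def degComp (F : Type*) [Field F] (m n N : ℕ) (i : ℕ) :
    Submodule F (Kbar F m n N) :=
  Submodule.span F {x : Kbar F m n N | ∃ p : List (Wt N),
    p.length = i + 1 ∧ (∀ v ∈ p, IsWeight m n v) ∧ p.Chain' GammaAdj ∧
    x = toKbar F m n N (pathEl F m n N p)}

/-- The linear map `x ↦ e_λ x e_μ` on `K̄_m^n`. -/
noncomputable def sandwich (F : Type*) [Field F] (m n N : ℕ) (la mu : Wt N) :
    Kbar F m n N →ₗ[F] Kbar F m n N :=
  (LinearMap.mulLeft F (toKbar F m n N (eW F m n N la))).comp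
    (LinearMap.mulRight F (toKbar F m n N (eW F m n N mu)))

end Kh

namespace Kh

variable {N : ℕ}

/-- The value `±1` of a weight at a position. -/
def sg (l : Wt N) (t : Fin N) : ℤ := if l t = true then 1 else -1

/-- Prefix sums of a weight. -/
def W (l : Wt N) (t : ℕ) : ℤ := ∑ s : Fin N, if s.val < t then sg l s else 0

lemma W_succ (l : Wt N) (t : Fin N) : W l (t.val + 1) = W l t.val + sg l t := by
  unfold W
  have : sg l t = ∑ s : Fin N, if s = t then sg l s else 0 := by simp
  rw [this, ← Finset.sum_add_distrib]
  apply Finset.sum_congr rfl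
  intro s _
  have : s = t ↔ s.val = t.val := Fin.ext_iff
  split_ifs <;> first | omega | simp

lemma sg_swap (l : Wt N) (i j : Fin N) (hi : l i = true) (hj : l j = false) (t : Fin N) :
    sg (swapC l i j) t = sg l t - (if t = i then 2 else 0) + (if t = j then 2 else 0) := by
  have hij : i ≠ j := by rintro rfl; simp [hi] at hj
  unfold sg swapC
  by_cases h1 : t = i
  · subst h1; simp [hi, hj, hij]
  · by_cases h2 : t = j
    · subst h2; simp [hi, hj, h1]
    · simp [h1, h2]

lemma W_swap (l : Wt N) (i j : Fin N) (hij : i < j) (hi : l i = true) (hj : l j = false) (t : ℕ) :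
    W (swapC l i j) t = W l t - (if i.val < t ∧ t ≤ j.val then 2 else 0) := by
  unfold W
  have h1 : ∀ s : Fin N, (if s.val < t then sg (swapC l i j) s else 0) =
      (if s.val < t then sg l s else 0) - (if s = i then (if i.val < t then 2 else 0) else 0)
        + (if s = j then (if j.val < t then 2 else 0) else 0) := by
    intro s
    rw [sg_swap l i j hi hj]
    by_cases h1 : s = i
    · subst h1
      have : s ≠ j := ne_of_lt hij
      simp [this]; split_ifs <;> simp
    · by_cases h2 : s = j
      · subst h2
        simp [h1]; split_ifs <;> simp
      · simp [h1, h2]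
  simp_rw [h1]
  rw [Finset.sum_add_distrib, Finset.sum_sub_distrib]
  simp only [Finset.sum_ite_eq', Finset.mem_univ, if_true]
  have : i.val < j.val := hij
  split_ifs <;> first | omega | simp

lemma cnt_diff (l : Wt N) (i j : Fin N) (hij : i ≤ j) :
    (cnt l true i j : ℤ) - cnt l false i j = W l (j.val + 1) - W l (i.val + 1) := by
  unfold cnt W
  rw [Set.ncard_eq_toFinset_card', Set.ncard_eq_toFinset_card']
  simp only [Set.toFinset_setOf, Finset.card_filter]
  push_cast
  rw [← Finset.sum_sub_distrib, ← Finset.sum_sub_distrib]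
  apply Finset.sum_congr rfl
  intro s _
  have h1 : i < s ↔ i.val < s.val := Iff.rfl
  have h2 : s ≤ j ↔ s.val ≤ j.val := Iff.rfl
  have h3 : i.val ≤ j.val := hij
  unfold sg
  simp only [h1, h2]
  cases hs : l s <;> simp <;> split_ifs <;> omega

lemma isCircle_iff (l : Wt N) (i j : Fin N) : IsCircle l i j ↔
    i.val < j.val ∧ l i = true ∧ l j = false ∧ W l j.val = W l (i.val + 1) ∧
      ∀ t : ℕ, i.val + 1 ≤ t → t ≤ j.val → W l (i.val + 1) ≤ W l t := by
  unfold IsCircle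
  constructor
  · rintro ⟨hij, hi, hj, hc, hk⟩
    have hs := W_succ l j
    have hd := cnt_diff l i j hij.le
    have hsj : sg l j = -1 := by simp [sg, hj]
    refine ⟨hij, hi, hj, by omega, ?_⟩
    intro t ht1 ht2
    rcases Nat.eq_or_lt_of_le ht1 with h | h
    · rw [h]
    · have hjN := j.isLt
      have := hk ⟨t - 1, by omega⟩ (by show i.val < t - 1; omega) (by show t - 1 < j.val; omega)
      have hd := cnt_diff l i ⟨t - 1, by omega⟩ (by show i.val ≤ t - 1; omega)
      simp only [Nat.sub_add_cancel (show 1 ≤ t by omega)] at hd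
      omega
  · rintro ⟨hij, hi, hj, hc, hk⟩
    have hs := W_succ l j
    have hd := cnt_diff l i j (le_of_lt hij)
    have hsj : sg l j = -1 := by simp [sg, hj]
    refine ⟨hij, hi, hj, by omega, ?_⟩
    intro k h1 h2
    have h1' : i.val < k.val := h1
    have h2' : k.val < j.val := h2
    have := hk (k.val + 1) (by omega) (by omega)
    have hd := cnt_diff l i k h1.le
    omega

lemma sg_true {l : Wt N} {t : Fin N} (h : l t = true) : sg l t = 1 := by simp [sg, h]
lemma sg_false {l : Wt N} {t : Fin N} (h : l t = false) : sg l t = -1 := by simp [sg, h]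

/-- A pair of adjacent positions `↓↑` is the only circle touching either one. -/
lemma unit_left {l : Wt N} {a b j : Fin N} (hab : b.val = a.val + 1) (hb : l b = false)
    (h : IsCircle l a j) : j = b := by
  rw [isCircle_iff] at h
  obtain ⟨h1, h2, h3, h4, h5⟩ := h
  by_contra hne
  have hne' : j.val ≠ b.val := fun h => hne (Fin.ext h)
  have := h5 (b.val + 1) (by omega) (by omega)
  have hs := W_succ l b
  rw [sg_false hb] at hs
  rw [hab] at *
  omega

lemma unit_right {l : Wt N} {a b c : Fin N} (hab : b.val = a.val + 1) (ha : l a = true)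
    (h : IsCircle l c b) : c = a := by
  rw [isCircle_iff] at h
  obtain ⟨h1, h2, h3, h4, h5⟩ := h
  by_contra hne
  have hne' : c.val ≠ a.val := fun h => hne (Fin.ext h)
  have := h5 a.val (by omega) (by omega)
  have hs := W_succ l a
  rw [sg_true ha] at hs
  rw [hab] at *
  omega

lemma noncross {l : Wt N} {p q r s : Fin N} (h : IsCircle l p q) (h' : IsCircle l r s)
    (h1 : p < r) (h2 : r < q) (h3 : q < s) : False := by
  rw [isCircle_iff] at h h'
  obtain ⟨_, _, hq, h4, h5⟩ := h
  obtain ⟨_, hr, _, h6, h7⟩ := h'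
  have h1' : p.val < r.val := h1
  have h2' : r.val < q.val := h2
  have h3' : q.val < s.val := h3
  have a1 := h7 (q.val + 1) (by omega) (by omega)
  have a2 := h5 r.val (by omega) (by omega)
  have hs := W_succ l q
  rw [sg_false hq] at hs
  have hs' := W_succ l r
  rw [sg_true hr] at hs'
  omega

lemma unit_circle {l : Wt N} {a b : Fin N} (hab : b.val = a.val + 1) (ha : l a = true)
    (hb : l b = false) : IsCircle l a b := by
  rw [isCircle_iff]
  refine ⟨by omega, ha, hb, by rw [hab], ?_⟩
  intro t h1 h2
  have : t = a.val + 1 := by omega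
  rw [this]

lemma wt_ext {l l' : Wt N} (h : ∀ t, sg l t = sg l' t) : l = l' := by
  funext t
  have := h t
  unfold sg at this
  cases h1 : l t <;> cases h2 : l' t <;> simp_all

lemma IsCircle.lt' {l : Wt N} {i j : Fin N} (h : IsCircle l i j) : i < j := h.1
lemma IsCircle.d {l : Wt N} {i j : Fin N} (h : IsCircle l i j) : l i = true := h.2.1
lemma IsCircle.u {l : Wt N} {i j : Fin N} (h : IsCircle l i j) : l j = false := h.2.2.1

/-- A unit step up: exchanging two adjacent positions `↓↑`. -/
def UStep (l w : Wt N) (a b : Fin N) : Prop :=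
  b.val = a.val + 1 ∧ l a = true ∧ l b = false ∧ w = swapC l a b

/-- Uniqueness of the ascending-descending path through a unit step. -/
lemma updown_unique {la om ka om' : Wt N} {a b d1 d2 c1 c2 e1 e2 : Fin N}
    (hU : UStep la om a b) (hD : IsCircle ka d1 d2) (hDs : om = swapC ka d1 d2) (hne : ka ≠ la)
    (hC : IsCircle la c1 c2) (hCs : om' = swapC la c1 c2)
    (hE : IsCircle ka e1 e2) (hEs : om' = swapC ka e1 e2) : om' = om := by
  obtain ⟨hab, ha, hb, hom⟩ := hU
  by_cases hca : c1 = a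
  · subst hca
    rw [unit_left hab hb hC] at hCs
    rw [hCs, hom]
  by_cases hcb : c2 = b
  · subst hcb
    exact absurd (unit_right hab ha hC) hca
  exfalso
  have hca2 : c2 ≠ a := by rintro rfl; have := hC.u; simp_all
  have hcb1 : c1 ≠ b := by rintro rfl; have := hC.d; simp_all
  have key : ∀ t : Fin N,
      - (if t = a then 2 else 0) + (if t = b then 2 else 0)
        + (if t = d1 then 2 else 0) - (if t = d2 then (2 : ℤ) else 0) =
      - (if t = c1 then 2 else 0) + (if t = c2 then 2 else 0)
        + (if t = e1 then 2 else 0) - (if t = e2 then (2 : ℤ) else 0) := by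
    intro t
    have k1 := sg_swap la a b ha hb t
    have k2 := sg_swap ka d1 d2 hD.d hD.u t
    have k3 := sg_swap la c1 c2 hC.d hC.u t
    have k4 := sg_swap ka e1 e2 hE.d hE.u t
    rw [← hom] at k1
    rw [← hDs] at k2
    rw [← hCs] at k3
    rw [← hEs] at k4
    linarith
  have habne : a ≠ b := by intro h; rw [h] at hab; omega
  have hd := hD.lt'
  have hc := hC.lt'
  have he := hE.lt'
  have ka' := key a
  have kb' := key b
  have kc1 := key c1
  have kc2 := key c2
  simp only [if_true, habne, habne.symm, Ne.symm hca, Ne.symm hcb, Ne.symm hca2, Ne.symm hcb1,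
    if_false] at ka' kb'
  have hA : a = d1 ∨ a = e2 := by
    by_contra hcon
    push Not at hcon
    simp only [hcon.1, hcon.2, if_false] at ka'
    split_ifs at ka' <;> omega
  have hB : b = d2 ∨ b = e1 := by
    by_contra hcon
    push Not at hcon
    simp only [hcon.1, hcon.2, if_false] at kb'
    split_ifs at kb' <;> omega
  have hab' : a < b := by show a.val < b.val; omega
  rcases hA with rfl | rfl <;> rcases hB with rfl | rfl
  · -- same circle
    apply hne
    apply wt_ext
    intro t
    have k1 := sg_swap la _ _ ha hb t
    have k2 := sg_swap ka _ _ hD.d hD.u t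
    rw [← hom] at k1
    rw [← hDs] at k2
    linarith
  · have h1 : c1 = d2 := by
      simp only [if_true, hca, hcb1, hc.ne, if_false] at kc1
      by_contra hcon
      simp only [hcon, if_false] at kc1
      split_ifs at kc1 <;> omega
    have h2 : c2 = e2 := by
      simp only [if_true, hca2, hcb, hc.ne', if_false] at kc2
      by_contra hcon
      simp only [hcon, if_false] at kc2
      split_ifs at kc2 <;> omega
    subst h1 h2
    refine noncross hD hE hab' ?_ hc
    have : a.val < c1.val := hd
    have h3 : c1.val ≠ b.val := fun h => hcb1 (Fin.ext h)
    show b.val < c1.val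
    omega
  · have h1 : c1 = e1 := by
      simp only [if_true, hca, hcb1, hc.ne, if_false] at kc1
      by_contra hcon
      simp only [hcon, if_false] at kc1
      split_ifs at kc1 <;> omega
    have h2 : c2 = d1 := by
      simp only [if_true, hca2, hcb, hc.ne', if_false] at kc2
      by_contra hcon
      simp only [hcon, if_false] at kc2
      split_ifs at kc2 <;> omega
    subst h1 h2
    refine noncross hE hD hc ?_ hab'
    have : c2.val < b.val := hd
    have h3 : c2.val ≠ a.val := fun h => hca2 (Fin.ext h)
    show c2.val < a.val
    omega
  · exact absurd (lt_trans hab' he) (lt_irrefl _)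

/-- Existence of another path, starting with a descending arrow. -/
lemma other_path {la om ka : Wt N} {a b d1 d2 : Fin N}
    (hU : UStep la om a b) (hD : IsCircle ka d1 d2) (hDs : om = swapC ka d1 d2) (hne : ka ≠ la) :
    ∃ z, GammaStep z la ∧ GammaAdj z ka := by
  obtain ⟨hab, ha, hb, hom⟩ := hU
  have habne : a ≠ b := by intro h; rw [h] at hab; omega
  have hd := hD.lt'
  have k1 : ∀ t, sg om t =
      sg la t - (if t = a then 2 else 0) + (if t = b then 2 else 0) := by
    intro t
    have := sg_swap la a b ha hb t
    rwa [← hom] at this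
  have k2 : ∀ t, sg om t =
      sg ka t - (if t = d1 then 2 else 0) + (if t = d2 then 2 else 0) := by
    intro t
    have := sg_swap ka d1 d2 hD.d hD.u t
    rwa [← hDs] at this
  have oma : om a = false := by rw [hom]; simp [swapC, hb]
  have omb : om b = true := by rw [hom]; simp [swapC, ha, habne.symm]
  have omd1 : om d1 = false := by rw [hDs]; simp [swapC, hD.u]
  have omd2 : om d2 = true := by rw [hDs]; simp [swapC, hD.d, hd.ne']
  have had2 : a ≠ d2 := by rintro rfl; simp_all
  have hbd1 : b ≠ d1 := by rintro rfl; simp_all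
  have omne : ∀ t, t ≠ d1 → t ≠ d2 → om t = ka t := by
    intro t h1 h2; rw [hDs]; simp [swapC, h1, h2]
  have omne' : ∀ t, t ≠ a → t ≠ b → om t = la t := by
    intro t h1 h2; rw [hom]; simp [swapC, h1, h2]
  have hD' := (isCircle_iff _ _ _).1 hD
  obtain ⟨w1, w2, w3, w4, w5⟩ := hD'
  by_cases hA : a = d1
  · by_cases hB : b = d2
    · exfalso
      subst hA hB
      apply hne
      apply wt_ext
      intro t
      have := k1 t
      have := k2 t
      linarith
    · -- case beta
      subst hA
      have kb : ka b = true := by rw [← omne b hbd1 hB]; exact omb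
      have sb := W_succ ka b
      rw [sg_true kb] at sb
      have hbv : b.val ≠ d2.val := fun h => hB (Fin.ext h)
      rw [← hab] at w4 w5
      have hex : ∃ t, b.val + 1 ≤ t ∧ W ka t ≤ W ka b.val := ⟨d2.val, by omega, w4.le⟩
      obtain ⟨t1, t2⟩ := Nat.find_spec hex
      have tmin : ∀ s, b.val + 1 ≤ s → s < Nat.find hex → W ka b.val < W ka s := by
        intro s h1 h2
        have := Nat.find_min hex h2
        by_contra hcon
        exact this ⟨h1, not_lt.1 hcon⟩
      have tle : Nat.find hex ≤ d2.val := Nat.find_min' hex ⟨by omega, w4.le⟩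
      set t := Nat.find hex
      have tne : t ≠ b.val + 1 := by intro h; rw [h] at t2; omega
      have hd2N := d2.isLt
      let e : Fin N := ⟨t - 1, by omega⟩
      have hev : e.val = t - 1 := rfl
      have se := W_succ ka e
      rw [hev, Nat.sub_add_cancel (by omega)] at se
      have he1 := tmin (t - 1) (by omega) (by omega)
      have hte := w5 t (by omega) tle
      have ke : ka e = false := by
        cases h : ka e
        · rfl
        · rw [sg_true h] at se; omega
      rw [sg_false ke] at se
      have hbe : b.val < e.val := by omega
      have hed2 : e.val < d2.val := by omega
      have hE : IsCircle ka b e := by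
        rw [isCircle_iff]
        refine ⟨hbe, kb, ke, by rw [hev]; omega, ?_⟩
        intro s h1 h2
        have := tmin s (by omega) (by omega)
        omega
      have nbe : b ≠ e := ne_of_lt hbe
      have ned2 : e ≠ d2 := ne_of_lt hed2
      have nae : a ≠ e := by intro h; rw [h] at hab; omega
      have hz := W_swap ka b e hbe kb ke
      have hz1 : swapC ka b e e = true := by simp [swapC, nbe.symm, kb]
      have hz2 : swapC ka b e d2 = false := by simp [swapC, Ne.symm ned2, Ne.symm hB, w3]
      have hF : IsCircle (swapC ka b e) e d2 := by
        rw [isCircle_iff]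
        refine ⟨hed2, hz1, hz2, ?_, ?_⟩
        · rw [hz, hz, if_neg (by omega), if_neg (by omega), w4, hev,
            Nat.sub_add_cancel (by omega)]
          omega
        · intro s h1 h2
          rw [hz, hz, if_neg (by omega), if_neg (by omega), hev,
            Nat.sub_add_cancel (by omega)]
          have := w5 s (by omega) h2
          omega
      refine ⟨swapC ka b e, ⟨e, d2, hF, ?_⟩, Or.inr ⟨b, e, hE, rfl⟩⟩
      apply wt_ext
      intro s
      rw [sg_swap _ _ _ hz1 hz2, sg_swap _ _ _ kb ke]
      have := k1 s
      have := k2 s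
      linarith
  · by_cases hB : b = d2
    · -- case alpha
      subst hB
      have kaa : ka a = false := by rw [← omne a hA habne]; exact oma
      have sa := W_succ ka a
      rw [sg_false kaa, ← hab] at sa
      have hav : a.val ≠ d1.val := fun h => hA (Fin.ext h)
      let P : ℕ → Prop := fun t => d1.val + 1 ≤ t ∧ W ka t ≤ W ka b.val
      have hP0 : P (d1.val + 1) := ⟨le_rfl, w4.ge⟩
      have hPt : P (Nat.findGreatest P a.val) :=
        Nat.findGreatest_spec (m := d1.val + 1) (by omega) hP0
      have hle : Nat.findGreatest P a.val ≤ a.val := Nat.findGreatest_le _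
      have hgt : ∀ s, Nat.findGreatest P a.val < s → s ≤ a.val → ¬ P s :=
        fun s h1 h2 => Nat.findGreatest_is_greatest h1 h2
      set t := Nat.findGreatest P a.val
      obtain ⟨t1, t2⟩ := hPt
      have tmax : ∀ s, t < s → s ≤ a.val → W ka b.val < W ka s := by
        intro s h1 h2
        have := hgt s h1 h2
        by_contra hcon
        exact this ⟨by omega, not_lt.1 hcon⟩
      have tne : t ≠ a.val := by intro h; rw [h] at t2; omega
      have haN := a.isLt
      let e : Fin N := ⟨t, by omega⟩
      have hev : e.val = t := rfl
      have se := W_succ ka e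
      rw [hev] at se
      have he1 := tmax (t + 1) (by omega) (by omega)
      have hte := w5 t (by omega) (by omega)
      have ke : ka e = true := by
        cases h : ka e
        · rw [sg_false h] at se; omega
        · rfl
      rw [sg_true ke] at se
      have hea : e.val < a.val := by omega
      have hde : d1.val < e.val := by omega
      have hE : IsCircle ka e a := by
        rw [isCircle_iff]
        refine ⟨hea, ke, kaa, by rw [hev]; omega, ?_⟩
        intro s h1 h2
        have := tmax s (by omega) (by omega)
        rw [hev]
        omega
      have nea : e ≠ a := ne_of_lt hea
      have nde : d1 ≠ e := ne_of_lt hde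
      have hz := W_swap ka e a hea ke kaa
      have hz1 : swapC ka e a d1 = true := by simp [swapC, nde, Ne.symm hA, w2]
      have hz2 : swapC ka e a e = false := by simp [swapC, kaa]
      have hF : IsCircle (swapC ka e a) d1 e := by
        rw [isCircle_iff]
        refine ⟨hde, hz1, hz2, ?_, ?_⟩
        · rw [hz, hz, if_neg (by omega), if_neg (by omega), hev]
          omega
        · intro s h1 h2
          rw [hz, hz, if_neg (by omega), if_neg (by omega)]
          have := w5 s (by omega) (by omega)
          omega
      refine ⟨swapC ka e a, ⟨d1, e, hF, ?_⟩, Or.inr ⟨e, a, hE, rfl⟩⟩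
      apply wt_ext
      intro s
      rw [sg_swap _ _ _ hz1 hz2, sg_swap _ _ _ ke kaa]
      have := k1 s
      have := k2 s
      linarith
    · -- disjoint case
      have kaa : ka a = false := by rw [← omne a hA had2]; exact oma
      have kab : ka b = true := by rw [← omne b hbd1 hB]; exact omb
      let z := swapC la d1 d2
      have ld1 : la d1 = false := by rw [← omne' d1 (Ne.symm hA) (Ne.symm hbd1)]; exact omd1
      have ld2 : la d2 = true := by rw [← omne' d2 (Ne.symm had2) (Ne.symm hB)]; exact omd2
      have za : z a = true := by simp [z, swapC, hA, had2, ha]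
      have zb : z b = false := by simp [z, swapC, hbd1, hB, hb]
      have zd1 : z d1 = true := by simp [z, swapC, ld2]
      have zd2 : z d2 = false := by simp [z, swapC, ld1, hd.ne']
      have hzla : la = swapC z d1 d2 := by
        funext t
        by_cases h1 : t = d1
        · subst h1; simp [swapC, zd2, ld1]
        · by_cases h2 : t = d2
          · subst h2; simp [swapC, zd1, ld2, h1]
          · simp [swapC, z, h1, h2]
      have hzka : ka = swapC z a b := by
        apply wt_ext
        intro t
        rw [sg_swap _ _ _ za zb]
        have r1 := sg_swap z d1 d2 zd1 zd2 t
        rw [← hzla] at r1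
        have := k1 t
        have := k2 t
        linarith
      have hab' : a < b := by show a.val < b.val; omega
      have hz := W_swap z a b hab' za zb
      rw [← hzka] at hz
      have va1 : a.val ≠ d1.val := fun h => hA (Fin.ext h)
      have va2 : a.val ≠ d2.val := fun h => had2 (Fin.ext h)
      have vb1 : b.val ≠ d1.val := fun h => hbd1 (Fin.ext h)
      have vb2 : b.val ≠ d2.val := fun h => hB (Fin.ext h)
      refine ⟨z, ⟨d1, d2, ?_, hzla⟩, Or.inl ⟨a, b, unit_circle hab za zb, hzka⟩⟩
      rw [isCircle_iff]
      refine ⟨w1, zd1, zd2, ?_, ?_⟩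
      · have e1 := hz d2.val
        have e2 := hz (d1.val + 1)
        rw [if_neg (by omega)] at e1 e2
        omega
      · intro s h1 h2
        have e1 := hz s
        have e2 := hz (d1.val + 1)
        rw [if_neg (by omega)] at e2
        have := w5 s h1 h2
        split_ifs at e1 <;> omega

/-- Two-step unit paths between the same endpoints use the same two places. -/
lemma two_unit {la mu o1 o2 : Wt N} {a a' b b' c c' d d' : Fin N}
    (h1 : UStep la o1 a a') (h2 : UStep o1 mu b b')
    (h3 : UStep la o2 c c') (h4 : UStep o2 mu d d') : (c = a ∧ o2 = o1) ∨ (c = b ∧ d = a) := by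
  obtain ⟨p1, q1, r1, s1⟩ := h1
  obtain ⟨p2, q2, r2, s2⟩ := h2
  obtain ⟨p3, q3, r3, s3⟩ := h3
  obtain ⟨p4, q4, r4, s4⟩ := h4
  have key : ∀ t : ℕ, (if t = a.val + 1 then 2 else 0) + (if t = b.val + 1 then (2:ℤ) else 0) =
      (if t = c.val + 1 then 2 else 0) + (if t = d.val + 1 then (2:ℤ) else 0) := by
    intro t
    have w1 := W_swap la a a' (by show a.val < a'.val; omega) q1 r1 t
    have w2 := W_swap o1 b b' (by show b.val < b'.val; omega) q2 r2 t
    have w3 := W_swap la c c' (by show c.val < c'.val; omega) q3 r3 t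
    have w4 := W_swap o2 d d' (by show d.val < d'.val; omega) q4 r4 t
    rw [← s1] at w1
    rw [← s2] at w2
    rw [← s3] at w3
    rw [← s4] at w4
    split_ifs at * <;> omega
  by_cases hca : c = a
  · left
    refine ⟨hca, ?_⟩
    have : c' = a' := Fin.ext (by rw [p1, p3, hca])
    rw [s1, s3, hca, this]
  · right
    have hca' : c.val ≠ a.val := fun h => hca (Fin.ext h)
    have k1 := key (c.val + 1)
    have k2 := key (a.val + 1)
    have e1 : c.val = b.val := by split_ifs at k1 <;> omega
    have e2 : d.val = a.val := by split_ifs at k2 <;> omega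
    exact ⟨Fin.ext e1, Fin.ext e2⟩

lemma no_updown {la mu o1 o2 w : Wt N} {a a' b b' c c' d d' e1 e2 f1 f2 : Fin N}
    (h1 : UStep la o1 a a') (h2 : UStep o1 mu b b')
    (h3 : UStep la o2 c c') (h4 : UStep o2 mu d d') (hne : o2 ≠ o1)
    (hE : IsCircle la e1 e2) (hEs : w = swapC la e1 e2)
    (hF : IsCircle mu f1 f2) (hFs : w = swapC mu f1 f2) : False := by
  have key0 := two_unit h1 h2 h3 h4
  rcases key0 with ⟨_, h⟩ | ⟨rfl, rfl⟩
  · exact hne h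
  obtain ⟨p1, q1, r1, s1⟩ := h1
  obtain ⟨p2, q2, r2, s2⟩ := h2
  obtain ⟨p3, q3, r3, s3⟩ := h3
  have : b' = c' := Fin.ext (by omega)
  subst this
  have hac : d ≠ c := by
    rintro rfl
    apply hne
    have : b' = a' := Fin.ext (by omega)
    rw [s1, s3, this]
  have hca' : c ≠ a' := by rintro rfl; simp_all
  have hac' : d ≠ b' := by rintro rfl; simp_all
  have haa' : d ≠ a' := by intro h; rw [h] at p1; omega
  have hcc' : c ≠ b' := by intro h; rw [h] at p2; omega
  have key : ∀ t : Fin N,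
      - (if t = e1 then 2 else 0) + (if t = e2 then (2 : ℤ) else 0) =
      - (if t = d then 2 else 0) + (if t = a' then (2 : ℤ) else 0)
       - (if t = c then 2 else 0) + (if t = b' then (2 : ℤ) else 0)
       - (if t = f1 then 2 else 0) + (if t = f2 then (2 : ℤ) else 0) := by
    intro t
    have k1 := sg_swap la d a' q1 r1 t
    have k2 := sg_swap o1 c b' q2 r2 t
    have k3 := sg_swap la e1 e2 hE.d hE.u t
    have k4 := sg_swap mu f1 f2 hF.d hF.u t
    rw [← s1] at k1
    rw [← s2] at k2
    rw [← hEs] at k3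
    rw [← hFs] at k4
    linarith
  have hf := hF.lt'
  have he2d : d ≠ e2 := by rintro rfl; have := hE.u; simp_all
  have he2c : c ≠ e2 := by rintro rfl; have := hE.u; simp_all
  have hd := key d
  have hc := key c
  simp only [if_true, he2d, he2c, hac, hac.symm, hca', hac', haa', hcc', if_false] at hd hc
  by_cases x1 : d = e1
  · subst x1
    have := unit_left p1 r1 hE
    subst this
    have hb := key b'
    simp only [hac.symm, if_false] at hc
    have y1 : c = f2 := by
      by_contra hcon
      simp only [hcon, if_false] at hc
      split_ifs at hc <;> omega
    have hb'e : b' ≠ e2 := by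
      intro h; apply hac; apply Fin.ext; rw [h] at p2; omega
    simp only [if_true, hcc'.symm, hac'.symm, hb'e, if_false] at hb
    have y2 : b' = f1 := by
      by_contra hcon
      simp only [hcon, if_false] at hb
      split_ifs at hb <;> omega
    subst y1 y2
    have : b'.val < c.val := hf
    omega
  by_cases x2 : c = e1
  · subst x2
    have := unit_left p3 r3 hE
    subst this
    have hb := key a'
    simp only [hac, if_false] at hd
    have y1 : d = f2 := by
      by_contra hcon
      simp only [hcon, if_false] at hd
      split_ifs at hd <;> omega
    have hb'e : a' ≠ e2 := by
      intro h; apply hac; apply Fin.ext; rw [h] at p1; omega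
    simp only [if_true, hca'.symm, haa'.symm, hb'e, if_false] at hb
    have y2 : a' = f1 := by
      by_contra hcon
      simp only [hcon, if_false] at hb
      split_ifs at hb <;> omega
    subst y1 y2
    have : a'.val < d.val := hf
    omega
  simp only [x1, x2, if_false] at hc hd
  have y1 : d = f2 := by
    by_contra hcon
    simp only [hcon, if_false] at hd
    split_ifs at hd <;> omega
  have y2 : c = f2 := by
    by_contra hcon
    simp only [hcon, if_false] at hc
    split_ifs at hc <;> omega
  exact hac (y1.trans y2.symm)

/-! ### Heights -/

lemma sum_lt_card (S : Finset (Fin N)) :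
    2 * ∑ i ∈ S, (S.filter (fun j => j < i)).card + S.card = S.card * S.card := by
  have h1 : ∑ i ∈ S, (S.filter (fun j => j < i)).card =
      ∑ i ∈ S, (S.filter (fun j => i < j)).card := by
    simp only [Finset.card_filter]
    rw [Finset.sum_comm]
  have h2 : ∀ i ∈ S, (S.filter (fun j => j < i)).card + (S.filter (fun j => i < j)).card + 1
      = S.card := by
    intro i hi
    have : S.card = ∑ j ∈ S, ((if j < i then 1 else 0) + (if i < j then 1 else 0) +
        (if j = i then 1 else 0)) := by
      rw [Finset.card_eq_sum_ones]
      apply Finset.sum_congr rfl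
      intro j _
      rcases lt_trichotomy j i with h | h | h
      · simp [h, h.ne, h.le]
      · simp [h]
      · simp [h, h.ne', h.le]
    rw [this, Finset.sum_add_distrib, Finset.sum_add_distrib, Finset.card_filter,
      Finset.card_filter]
    simp [hi]
  have h3 := Finset.sum_congr rfl h2
  rw [Finset.sum_add_distrib, Finset.sum_add_distrib, ← h1] at h3
  simp at h3
  omega

lemma height_formula {m n : ℕ} {l : Wt N} (h : IsWeight m n l) :
    2 * height l + m * m = 2 * (∑ i : Fin N, if l i = true then i.val else 0) + m := by
  let S : Finset (Fin N) := Finset.univ.filter (fun i => l i = true)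
  have hS : S.card = m := by
    rw [← h.1, Set.ncard_eq_toFinset_card']
    simp [S]
  have h1 : ∀ i ∈ S, {j : Fin N | j < i ∧ l j = false}.ncard + (S.filter (fun j => j < i)).card
      = i.val := by
    intro i _
    rw [Set.ncard_eq_toFinset_card']
    simp only [Set.toFinset_setOf, S, Finset.filter_filter]
    have : i.val = (Finset.univ.filter (fun j : Fin N => j < i)).card := by
      have := Fin.card_Iio i
      rw [← this]; congr 1; ext; simp
    rw [this, Finset.card_filter, Finset.card_filter, Finset.card_filter,
      ← Finset.sum_add_distrib]
    apply Finset.sum_congr rfl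
    intro j _
    cases l j <;> simp
  have h2 := Finset.sum_congr rfl h1
  rw [Finset.sum_add_distrib] at h2
  have h3 := sum_lt_card S
  have h4 : height l = ∑ i ∈ S, {j : Fin N | j < i ∧ l j = false}.ncard := by
    unfold height
    simp only [S, Finset.sum_filter]
  have h5 : (∑ i : Fin N, if l i = true then i.val else 0) = ∑ i ∈ S, i.val := by
    simp only [S, Finset.sum_filter]
  rw [h4, h5, ← h2]
  rw [hS] at h3
  omega

lemma swapC_eq (l : Wt N) (i j : Fin N) : swapC l i j = l ∘ (Equiv.swap i j) := by
  funext t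
  simp only [swapC, Function.comp, Equiv.swap_apply_def]
  split_ifs <;> rfl

lemma isWeight_swap {m n : ℕ} {l : Wt N} (i j : Fin N) :
    IsWeight m n (swapC l i j) ↔ IsWeight m n l := by
  have h : ∀ b : Bool, {t : Fin N | swapC l i j t = b}.ncard = {t : Fin N | l t = b}.ncard := by
    intro b
    rw [swapC_eq]
    have : {t : Fin N | (l ∘ (Equiv.swap i j)) t = b} = (Equiv.swap i j) '' {t | l t = b} := by
      ext t
      rw [Equiv.image_eq_preimage_symm]
      simp
    rw [this, Set.ncard_image_of_injective _ (Equiv.injective _)]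
  unfold IsWeight
  rw [h, h]

lemma height_swap {m n : ℕ} {l : Wt N} (hl : IsWeight m n l) {i j : Fin N} (hij : i < j)
    (hi : l i = true) (hj : l j = false) :
    height (swapC l i j) + i.val = height l + j.val := by
  have h1 := height_formula hl
  have h2 := height_formula ((isWeight_swap i j).2 hl)
  have h3 : (∑ t : Fin N, if swapC l i j t = true then t.val else 0) + i.val =
      (∑ t : Fin N, if l t = true then t.val else 0) + j.val := by
    have e1 : i.val = ∑ t : Fin N, if t = i then t.val else 0 := by simp
    have e2 : j.val = ∑ t : Fin N, if t = j then t.val else 0 := by simp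
    rw [e1, e2, ← Finset.sum_add_distrib, ← Finset.sum_add_distrib]
    apply Finset.sum_congr rfl
    intro t _
    by_cases h1 : t = i
    · subst h1; simp [swapC, hi, hj, hij.ne]
    · by_cases h2 : t = j
      · subst h2; simp [swapC, hi, hj, h1]
      · simp [swapC, h1, h2]
  omega

lemma step_height {m n : ℕ} {l w : Wt N} (hl : IsWeight m n l) (h : GammaStep l w) :
    IsWeight m n w ∧ height l < height w := by
  obtain ⟨i, j, hc, rfl⟩ := h
  refine ⟨(isWeight_swap i j).2 hl, ?_⟩
  have := height_swap hl hc.lt' hc.d hc.u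
  have h2 : i.val < j.val := hc.lt'
  omega

lemma step_weight {m n : ℕ} {l w : Wt N} (hw : IsWeight m n w) (h : GammaStep l w) :
    IsWeight m n l := by
  obtain ⟨i, j, hc, rfl⟩ := h
  exact (isWeight_swap i j).1 hw

lemma step_unit {m n : ℕ} {l w : Wt N} (hl : IsWeight m n l) (h : GammaStep l w)
    (hh : height w ≤ height l + 1) : ∃ a b, UStep l w a b := by
  obtain ⟨i, j, hc, rfl⟩ := h
  have := height_swap hl hc.lt' hc.d hc.u
  have h2 : i.val < j.val := hc.lt'
  exact ⟨i, j, by omega, hc.d, hc.u, rfl⟩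

/-! ### The algebra -/

section Alg

variable (F : Type*) [Field F] (m n : ℕ)

/-- The image of an arrow. -/
noncomputable def A (u w : Wt N) : Kbar F m n N := toKbar F m n N (arW F m n N u w)

lemma rel_zero {x : FA F m n N} (h : KbarRel F m n N x 0) : toKbar F m n N x = 0 := by
  have := RingQuot.mkAlgHom_rel F h
  rw [map_zero] at this
  exact this

lemma genA_zero {la mu : Wt N} (h1 : IsWeight m n la) (h2 : IsWeight m n mu) (hne : la ≠ mu)
    {x y : Wt N} (hxy : x ≠ y) (hx1 : GammaAdj la x) (hx2 : GammaAdj x mu)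
    (hy1 : GammaAdj la y) (hy2 : GammaAdj y mu) :
    ∑ w : Wt N, A F m n la w * A F m n w mu = 0 := by
  have h := rel_zero F m n (KbarRel.genA la mu h1 h2 hne (by
    have : 1 < {nu : Wt N | GammaAdj la nu ∧ GammaAdj nu mu}.ncard := by
      rw [Set.one_lt_ncard (Set.toFinite _)]
      exact ⟨x, ⟨hx1, hx2⟩, y, ⟨hy1, hy2⟩, hxy⟩
    exact this))
  unfold GenA at h
  rw [finsum_eq_sum_of_fintype, map_sum] at h
  simpa only [map_mul, A] using h

lemma A_zero {u w : Wt N} (h : ¬ GammaAdj u w) : A F m n u w = 0 := by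
  unfold A arW
  rw [dif_neg (fun h' => h h'.2.2), map_zero]

lemma adj_symm {u w : Wt N} (h : GammaAdj u w) : GammaAdj w u := Or.symm h

/-- If `P` kills every descending arrow out of `la`, then it kills every path
"unit step up from `la`, then down". -/
lemma kill {la om ka : Wt N} {a b : Fin N} (hla : IsWeight m n la) (hU : UStep la om a b)
    (hk : GammaStep ka om) (P : Kbar F m n N)
    (hP : ∀ z, GammaStep z la → P * A F m n la z = 0) :
    P * (A F m n la om * A F m n om ka) = 0 := by
  have hstep : GammaStep la om := ⟨a, b, unit_circle hU.1 hU.2.1 hU.2.2.1, hU.2.2.2⟩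
  have hom := (step_height hla hstep).1
  have hka := step_weight hom hk
  by_cases hne : ka = la
  · subst hne
    have h := rel_zero F m n (KbarRel.genD ka hla a b (unit_circle hU.1 hU.2.1 hU.2.2.1))
    unfold GenD at h
    rw [← hU.2.2.2] at h
    simp only [finsum_eq_sum_of_fintype, map_add, map_sum, map_mul] at h
    have h' := congrArg (fun x => P * x) h
    simp only [mul_add, Finset.mul_sum, mul_zero] at h'
    rw [Finset.sum_eq_zero, add_zero] at h'
    · exact h'
    · intro z _
      apply Finset.sum_eq_zero
      intro d1 _
      apply Finset.sum_eq_zero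
      intro d2 _
      split_ifs with hc
      · rw [map_zsmul, map_mul, mul_smul_comm, ← mul_assoc]
        have := hP z ⟨d1, d2, hc⟩
        unfold A at this
        rw [this, zero_mul]
        exact smul_zero _
      · simp
  · obtain ⟨d1, d2, hD, hDs⟩ := id hk
    obtain ⟨z, hz1, hz2⟩ := other_path hU hD hDs hne
    have hzom : om ≠ z := by
      rintro rfl
      have h1 := (step_height hla hstep).2
      have h2 := (step_height hom hz1).2
      omega
    have h := genA_zero F m n hla hka (Ne.symm hne) hzom (Or.inl hstep) (Or.inr hk)
      (Or.inr hz1) hz2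
    have h' := congrArg (fun x => P * x) h
    simp only [Finset.mul_sum, mul_zero] at h'
    rw [Finset.sum_eq_single om] at h'
    · exact h'
    · intro w _ hw
      by_cases hw1 : GammaAdj la w
      · rcases hw1 with hw1 | hw1
        · by_cases hw2 : GammaAdj w ka
          · exfalso
            have hwW := (step_height hla hw1)
            rcases hw2 with hw2 | hw2
            · have e1 := (step_height hwW.1 hw2).2
              have e2 := (step_height hka hk).2
              have e3 := height_swap hla (show a < b by show a.val < b.val; have := hU.1; omega)
                hU.2.1 hU.2.2.1
              rw [← hU.2.2.2] at e3
              have := hU.1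
              have := hwW.2
              omega
            · obtain ⟨c1, c2, hC, hCs⟩ := hw1
              obtain ⟨e1, e2, hE, hEs⟩ := hw2
              exact hw (updown_unique hU hD hDs hne hC hCs hE hEs)
          · rw [A_zero F m n hw2, mul_zero, mul_zero]
        · rw [← mul_assoc, hP w hw1, zero_mul]
      · rw [A_zero F m n hw1, zero_mul, mul_zero]
    · simp

/-- Product of the first `h` arrows of a path. -/
noncomputable def pre (v : ℕ → Wt N) : ℕ → FA F m n N
  | 0 => 1
  | h + 1 => pre v h * arW F m n N (v h) (v (h + 1))

lemma pre_congr {v v' : ℕ → Wt N} (h : ℕ) (hv : ∀ t, t ≤ h → v t = v' t) :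
    pre F m n v h = pre F m n v' h := by
  induction h with
  | zero => rfl
  | succ h ih =>
    simp only [pre]
    rw [ih (fun t ht => hv t (by omega)), hv h (by omega), hv (h + 1) le_rfl]

lemma pathEl_ofFn_succ (v : ℕ → Wt N) (r : ℕ) :
    pathEl F m n N (List.ofFn (fun t : Fin (r + 1 + 1) => v t.val)) =
      arW F m n N (v 0) (v 1) *
        pathEl F m n N (List.ofFn (fun t : Fin (r + 1) => v (t.val + 1))) := by
  rw [List.ofFn_succ, List.ofFn_succ, List.ofFn_succ]
  simp [pathEl]

lemma pathEl_split (v : ℕ → Wt N) (q r : ℕ) :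
    pathEl F m n N (List.ofFn (fun t : Fin (q + r + 1) => v t.val)) =
      pre F m n v q * pathEl F m n N (List.ofFn (fun t : Fin (r + 1) => v (t.val + q))) := by
  induction q generalizing r with
  | zero => 
    have : 0 + r = r := by omega
    simp only [pre, one_mul, add_zero]
    rw [this]
  | succ q ih =>
    have e : q + 1 + r = q + (r + 1) := by omega
    rw [e, ih (r + 1), pathEl_ofFn_succ F m n (fun t => v (t + q)) r]
    simp only [pre, mul_assoc, zero_add]
    have e1 : ∀ t, t + 1 + q = t + (q + 1) := by intro t; omega
    simp only [e1, zero_add, add_comm 1 q]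

lemma pre_kill (v : ℕ → Wt N) (k : ℕ)
    (hw : ∀ t, t ≤ k → IsWeight m n (v t))
    (hU : ∀ t, t < k → ∃ a b, UStep (v t) (v (t + 1)) a b)
    (h0 : height (v 0) = 0) (h : ℕ) (hk : h ≤ k) :
    ∀ z, GammaStep z (v h) → toKbar F m n N (pre F m n v h) * A F m n (v h) z = 0 := by
  induction h with
  | zero =>
    intro z hz
    have := (step_height (step_weight (hw 0 hk) hz) hz).2
    omega
  | succ h ih =>
    intro z hz
    obtain ⟨a, b, hab⟩ := hU h (by omega)
    have := kill F m n (hw h (by omega)) hab hz (toKbar F m n N (pre F m n v h)) (ih (by omega))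
    simp only [pre, map_mul]
    rw [mul_assoc]
    exact this

end Alg


/-- (0-based: `λ_t = v (t-1)`.)  Let `p` be an ascending path
with `|λ_1| = 0` and `|λ_{k+1}| = k`.  If `ν ≠ λ_i` is adjacent to `λ_{i-1}` and
`λ_{i+1}` with height strictly between theirs, and some weight `κ` adjacent to both
`λ_{i-1}` and `λ_{i+1}` has height `< |λ_{i-1}|`, then in `K̄_m^n` the image of `p`
equals the negative of the image of the path obtained by replacing `λ_i` with `ν`. -/
theorem statement18 (F : Type*) [Field F] (m n : ℕ) (hm : 1 ≤ m) (hn : 1 ≤ n)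
    (N : ℕ) (hN : N = m + n)
    (k : ℕ) (v : ℕ → Wt N)
    (hw : ∀ t, t ≤ k → IsWeight m n (v t))
    (hasc : ∀ t, t < k → GammaStep (v t) (v (t + 1)))
    (h0 : height (v 0) = 0) (hkh : height (v k) = k)
    (i : ℕ) (hi1 : 1 < i) (hik : i ≤ k)
    (nu : Wt N) (hnuW : IsWeight m n nu) (hnune : nu ≠ v (i - 1))
    (hnu1 : GammaAdj (v (i - 2)) nu) (hnu2 : GammaAdj nu (v i))
    (hh1 : height (v (i - 2)) < height nu) (hh2 : height nu < height (v i))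
    (ka : Wt N) (hkaW : IsWeight m n ka)
    (hka1 : GammaAdj (v (i - 2)) ka) (hka2 : GammaAdj ka (v i))
    (hkah : height ka < height (v (i - 2))) :
    toKbar F m n N (pathEl F m n N (List.ofFn (fun t : Fin (k + 1) => v t.val))) =
      - toKbar F m n N (pathEl F m n N (List.ofFn (fun t : Fin (k + 1) =>
          if t.val = i - 1 then nu else v t.val))) := by
  have hmono : ∀ t, t < k → height (v t) < height (v (t + 1)) := fun t ht =>
    (step_height (hw t ht.le) (hasc t ht)).2
  have hlow : ∀ t, t ≤ k → t ≤ height (v t) := by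
    intro t
    induction t with
    | zero => intro _; omega
    | succ t ih =>
      intro ht
      have := ih (by omega)
      have := hmono t (by omega)
      omega
  have hupp : ∀ s, s ≤ k → height (v (k - s)) ≤ k - s := by
    intro s
    induction s with
    | zero => intro _; simp [hkh]
    | succ s ih =>
      intro hs
      have h1 := ih (by omega)
      have h2 := hmono (k - (s + 1)) (by omega)
      have h3 : k - (s + 1) + 1 = k - s := by omega
      rw [h3] at h2
      omega
  have hht : ∀ t, t ≤ k → height (v t) = t := by
    intro t ht
    have h1 := hupp (k - t) (by omega)
    have h2 : k - (k - t) = t := by omega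
    rw [h2] at h1
    have := hlow t ht
    omega
  have hU : ∀ t, t < k → ∃ a b, UStep (v t) (v (t + 1)) a b := by
    intro t ht
    refine step_unit (hw t ht.le) (hasc t ht) ?_
    rw [hht t ht.le, hht (t + 1) ht]
  obtain ⟨q, rfl⟩ : ∃ q, i = q + 2 := ⟨i - 2, by omega⟩
  obtain ⟨r, rfl⟩ : ∃ r, k = q + (r + 1 + 1) := ⟨k - q - 2, by omega⟩
  simp only [show q + 2 - 2 = q from rfl, show q + 2 - 1 = q + 1 from rfl] at *
  have hq0 := hht q (by omega)
  have hq2 := hht (q + 2) (by omega)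
  have hWq := hw q (by omega)
  have hWq2 := hw (q + 2) (by omega)
  have sn1 : GammaStep (v q) nu := by
    rcases hnu1 with h | h
    · exact h
    · have := (step_height hnuW h).2
      omega
  have sn2 : GammaStep nu (v (q + 2)) := by
    rcases hnu2 with h | h
    · exact h
    · have := (step_height hWq2 h).2
      omega
  obtain ⟨a, a', u1⟩ := hU q (by omega)
  obtain ⟨b, b', u2⟩ := hU (q + 1) (by omega)
  obtain ⟨c, c', u3⟩ := step_unit hWq sn1 (by omega)
  obtain ⟨d, d', u4⟩ := step_unit hnuW sn2 (by omega)
  have hkill := pre_kill F m n v _ hw hU h0 q (by omega)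
  have hne : v q ≠ v (q + 2) := by
    intro h
    rw [h] at hq0
    omega
  have hsum := genA_zero F m n hWq hWq2 hne hnune (Or.inl sn1) (Or.inl sn2)
    (Or.inl (hasc q (by omega))) (Or.inl (hasc (q + 1) (by omega)))
  have main : toKbar F m n N (pre F m n v q) *
      (A F m n (v q) (v (q + 1)) * A F m n (v (q + 1)) (v (q + 2))) =
      - (toKbar F m n N (pre F m n v q) * (A F m n (v q) nu * A F m n nu (v (q + 2)))) := by
    have h' := congrArg (fun x => toKbar F m n N (pre F m n v q) * x) hsum
    simp only [Finset.mul_sum, mul_zero] at h'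
    rw [eq_neg_iff_add_eq_zero, add_comm, ← h', ← Finset.sum_pair hnune
      (f := fun w => toKbar F m n N (pre F m n v q) * (A F m n (v q) w * A F m n w (v (q + 2))))]
    apply Finset.sum_subset (Finset.subset_univ _)
    intro w _ hw'
    by_cases hw1 : GammaAdj (v q) w
    · rcases hw1 with hw1 | hw1
      · by_cases hw2 : GammaAdj w (v (q + 2))
        · exfalso
          have hwW := step_height hWq hw1
          rcases hw2 with hw2 | hw2
          · have e1 := step_height hwW.1 hw2
            obtain ⟨x, x', u5⟩ := step_unit hWq hw1 (by omega)
            obtain ⟨y, y', u6⟩ := step_unit hwW.1 hw2 (by omega)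
            apply hw'
            rcases two_unit u1 u2 u5 u6 with h | h
            · simp [h.2]
            · rcases two_unit u1 u2 u3 u4 with g | g
              · exact absurd g.2 hnune
              · have hx : x = c := h.1.trans g.1.symm
                have hx' : x' = c' := Fin.ext (by rw [u5.1, u3.1, hx])
                have : w = nu := by rw [u5.2.2.2, u3.2.2.2, hx, hx']
                simp [this]
          · obtain ⟨c1, c2, hC, hCs⟩ := hw1
            obtain ⟨e1, e2, hE, hEs⟩ := hw2
            exact no_updown u1 u2 u3 u4 hnune hC hCs hE hEs
        · rw [A_zero F m n hw2, mul_zero, mul_zero]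
      · rw [← mul_assoc, hkill w hw1, zero_mul]
    · rw [A_zero F m n hw1, zero_mul, mul_zero]
  have hpre : pre F m n (fun t => if t = q + 1 then nu else v t) q = pre F m n v q := by
    apply pre_congr
    intro t ht
    simp only [show t ≠ q + 1 by omega, if_false]
  rw [pathEl_split F m n v q (r + 1 + 1),
    pathEl_split F m n (fun t => if t = q + 1 then nu else v t) q (r + 1 + 1), hpre,
    pathEl_ofFn_succ F m n (fun t => v (t + q)) (r + 1),
    pathEl_ofFn_succ F m n (fun t => v (t + 1 + q)) r,
    pathEl_ofFn_succ F m n (fun t => if t + q = q + 1 then nu else v (t + q)) (r + 1),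
    pathEl_ofFn_succ F m n (fun t => if t + 1 + q = q + 1 then nu else v (t + 1 + q)) r]
  have hrest : ∀ t : ℕ, ¬ (t + 1 + 1 + q = q + 1) := by intro t; omega
  simp only [hrest, if_false]
  have n0 : ¬ (0 + q = q + 1) := by omega
  have n1 : 1 + q = q + 1 := by omega
  have n1' : 0 + 1 + q = q + 1 := by omega
  have n2 : 1 + 1 + q = q + 2 := by omega
  have n2' : ¬ (q + 2 = q + 1) := by omega
  simp only [n1, n1', n2, n2', zero_add, if_true, if_false, map_mul]
  have n3 : ¬ (q = q + 1) := by omega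
  simp only [n3, if_false]
  unfold A at main
  rw [eq_neg_iff_add_eq_zero] at main ⊢
  have hm' := congrArg (fun x => x * toKbar F m n N
    (pathEl F m n N (List.ofFn (fun t : Fin (r + 1) => v (t.val + 1 + 1 + q))))) main
  simpa only [mul_assoc, add_mul, zero_mul] using hm'

end Kh
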